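/- Weighted equivalence for the Bessel potential (Lemma 2.1(f), inequality (2.1)): for every 1 < p < ∞ and every α ∈ ℝ there exist constants C₁, C₂ > 0, depending only on α and p, such that for every Schwartz function f on ℝ³: C₂ ‖𝓜(⟨·⟩^{α} f)‖_{L^p(ℝ³)} ≤ ‖⟨·⟩^{α} 𝓜f‖_{L^p(ℝ³)} ≤ C₁ ‖𝓜(⟨·⟩^{α} f)‖_{L^p(ℝ³)}. -/

import Mathlib

open MeasureTheory Set
open scoped ENNReal

noncomputable section

/-- The Japanese bracket `⟨v⟩ = (1+|v|²)^(1/2)` on `ℝ³`. -/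
def jap (v : EuclideanSpace ℝ (Fin 3)) : ℝ := Real.sqrt (1 + ‖v‖ ^ 2)

/-- Partial derivative in the `i`-th coordinate direction. -/
def pd (i : Fin 3) (φ : EuclideanSpace ℝ (Fin 3) → ℝ) (v : EuclideanSpace ℝ (Fin 3)) : ℝ :=
  fderiv ℝ φ v (EuclideanSpace.single i 1)

/-- Iterated partial derivative along a list of coordinate directions (a multi-index). -/
def pdMany : List (Fin 3) → (EuclideanSpace ℝ (Fin 3) → ℝ) → EuclideanSpace ℝ (Fin 3) → ℝ
  | [], φ => φ
  | i :: l, φ => pd i (pdMany l φ)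

/-- The projection kernel `P(z) = Id − z⊗z/|z|²`. -/
def Pker (z : EuclideanSpace ℝ (Fin 3)) (i j : Fin 3) : ℝ :=
  (if i = j then (1 : ℝ) else 0) - z i * z j / ‖z‖ ^ 2

/-- The Landau matrix `A[h](v) = (1/(8π)) ∫ (P(v−z)/|v−z|) h(z) dz` (entry `(i,j)`). -/
def LandauA (h : EuclideanSpace ℝ (Fin 3) → ℝ) (v : EuclideanSpace ℝ (Fin 3)) (i j : Fin 3) : ℝ :=
  (1 / (8 * Real.pi)) * ∫ z, Pker (v - z) i j / ‖v - z‖ * h z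

/-- The Landau potential `a[h](v) = (1/(4π)) ∫ h(z)/|v−z| dz`. -/
def landaua (h : EuclideanSpace ℝ (Fin 3) → ℝ) (v : EuclideanSpace ℝ (Fin 3)) : ℝ :=
  (1 / (4 * Real.pi)) * ∫ z, h z / ‖v - z‖

/-- The Bessel potential operator `𝓜 = (I − Δ)⁻¹` via its integral kernel. -/
def besselM (h : EuclideanSpace ℝ (Fin 3) → ℝ) (v : EuclideanSpace ℝ (Fin 3)) : ℝ :=
  (1 / (4 * Real.pi)) * ∫ z, Real.exp (-‖v - z‖) / ‖v - z‖ * h z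

/-- Squared euclidean norm of the gradient. -/
def gradNormSq (φ : EuclideanSpace ℝ (Fin 3) → ℝ) (v : EuclideanSpace ℝ (Fin 3)) : ℝ :=
  ∑ i, (pd i φ v) ^ 2

/-- Euclidean norm of the gradient. -/
def gradNorm (φ : EuclideanSpace ℝ (Fin 3) → ℝ) (v : EuclideanSpace ℝ (Fin 3)) : ℝ :=
  Real.sqrt (gradNormSq φ v)


/-- Shorthand for `ℝ³`. -/
abbrev E3 : Type := EuclideanSpace ℝ (Fin 3)

open scoped SchwartzMap LineDeriv in
lemma exists_resolvent (g : 𝓢(E3, ℝ)) : ∃ h : 𝓢(E3, ℝ), ∀ x, g x =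
    h x - ∑ i : Fin 3, (∂_{EuclideanSpace.single i (1:ℝ)} (∂_{EuclideanSpace.single i (1:ℝ)} h)) x := by
  have ht1 : (fun x : E3 => (1 + ‖(2 * Real.pi) • x‖ ^ 2) ^ (-1 : ℝ)).HasTemperateGrowth := by
    have h1 := Function.hasTemperateGrowth_one_add_norm_sq_rpow (H := E3) (-1)
    have h2 : (fun x : E3 => (2 * Real.pi) • x).HasTemperateGrowth := by fun_prop
    exact h1.comp h2
  have ht2 : (fun x : E3 => 1 + ‖(2 * Real.pi) • x‖ ^ 2).HasTemperateGrowth := by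
    have h1 := Function.hasTemperateGrowth_one_add_norm_sq_rpow (H := E3) 1
    have h2 : (fun x : E3 => (2 * Real.pi) • x).HasTemperateGrowth := by fun_prop
    have h3 := h1.comp h2
    simpa [Function.comp_def] using h3
  let gc : 𝓢(E3, ℂ) := g.postcompCLM (Complex.ofRealCLM)
  let hc : 𝓢(E3, ℂ) := SchwartzMap.fourierMultiplierCLM ℂ
    (fun x : E3 => (1 + ‖(2 * Real.pi) • x‖ ^ 2) ^ (-1 : ℝ)) gc
  have key : SchwartzMap.fourierMultiplierCLM ℂ (fun x : E3 => 1 + ‖(2 * Real.pi) • x‖ ^ 2) hc = gc := by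
    rw [SchwartzMap.fourierMultiplierCLM_fourierMultiplierCLM_apply ht2 ht1]
    have : ((fun x : E3 => 1 + ‖(2 * Real.pi) • x‖ ^ 2) *
        (fun x : E3 => (1 + ‖(2 * Real.pi) • x‖ ^ 2) ^ (-1 : ℝ))) = fun _ => (1:ℝ) := by
      funext x
      have : 0 < 1 + ‖(2 * Real.pi) • x‖ ^ 2 := by positivity
      simp only [Pi.mul_apply, Real.rpow_neg_one]
      field_simp
    rw [this]
    simp
  have key2 : gc = hc - Laplacian.laplacian hc := by
    rw [SchwartzMap.laplacian_eq_fourierMultiplierCLM, ← key]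
    have e : (fun x : E3 => 1 + ‖(2 * Real.pi) • x‖ ^ 2) =
      (fun _ => (1:ℝ)) + ((2 * Real.pi) ^ 2) • (fun x : E3 => ‖x‖ ^ 2) := by
      funext x
      simp [norm_smul, mul_pow]
    rw [e]
    have ht3 : (fun x : E3 => ‖x‖^2).HasTemperateGrowth := by fun_prop
    simp only [SchwartzMap.fourierMultiplierCLM_apply]
    rw [SchwartzMap.smulLeftCLM_add (by fun_prop) (by fun_prop), SchwartzMap.smulLeftCLM_smul ht3]
    simp [FourierTransform.fourierInv_add, FourierTransform.fourierInv_smul]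
  refine ⟨hc.postcompCLM Complex.reCLM, fun x => ?_⟩
  have comm : ∀ (m : E3) (u : 𝓢(E3, ℂ)), ∂_{m} (u.postcompCLM Complex.reCLM) =
      (∂_{m} u).postcompCLM Complex.reCLM := by
    intro m u
    ext x
    simp only [SchwartzMap.lineDerivOp_apply_eq_fderiv, SchwartzMap.postcompCLM_apply]
    have : HasFDerivAt (fun x => Complex.reCLM (u x)) (Complex.reCLM.comp (fderiv ℝ u x)) x :=
      Complex.reCLM.hasFDerivAt.comp x u.differentiableAt.hasFDerivAt
    exact congrArg (fun L => L m) this.fderiv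
  have e1 := congrArg (fun u : 𝓢(E3, ℂ) => (u x).re) key2
  have e2 := SchwartzMap.laplacian_eq_sum (EuclideanSpace.basisFun (Fin 3) ℝ) hc
  rw [e2] at e1
  simp only [comm, SchwartzMap.postcompCLM_apply]
  simpa [gc, sum_apply] using e1

/-- The Yukawa profile as a function of the squared radius. -/
def YA (t : ℝ) : ℝ := Real.exp (-Real.sqrt t) / Real.sqrt t
/-- First derivative of `YA`. -/
def YA1 (t : ℝ) : ℝ :=
  -(Real.exp (-Real.sqrt t) * (1 / Real.sqrt t ^ 2 + 1 / Real.sqrt t ^ 3)) / 2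
/-- Second derivative of `YA`. -/
def YA2 (t : ℝ) : ℝ :=
  Real.exp (-Real.sqrt t) * (1 / Real.sqrt t ^ 3 + 3 / Real.sqrt t ^ 4 + 3 / Real.sqrt t ^ 5) / 4

lemma YA_hasDerivAt {t : ℝ} (ht : 0 < t) : HasDerivAt YA (YA1 t) t := by
  have hs : 0 < Real.sqrt t := Real.sqrt_pos.2 ht
  have h1 := Real.hasDerivAt_sqrt ht.ne'
  have h2 := (h1.neg.exp).div h1 hs.ne'
  refine h2.congr_deriv ?_
  unfold YA1
  simp only [Pi.neg_apply]
  field_simp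
  ring

lemma YA1_hasDerivAt {t : ℝ} (ht : 0 < t) : HasDerivAt YA1 (YA2 t) t := by
  have hs : 0 < Real.sqrt t := Real.sqrt_pos.2 ht
  have h1 := Real.hasDerivAt_sqrt ht.ne'
  have h2 := ((h1.neg.exp).mul (((hasDerivAt_const t (1:ℝ)).div (h1.pow 2) (pow_pos hs _).ne').add
    ((hasDerivAt_const t (1:ℝ)).div (h1.pow 3) (pow_pos hs _).ne'))).neg.div_const 2
  refine h2.congr_deriv ?_
  unfold YA2
  simp only [Pi.neg_apply, Pi.add_apply, Pi.div_apply, Pi.pow_apply]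
  field_simp
  norm_num
  ring

lemma YA_ode {t : ℝ} (ht : 0 < t) : YA t = 6 * YA1 t + 4 * t * YA2 t := by
  have hs : 0 < Real.sqrt t := Real.sqrt_pos.2 ht
  have : t = Real.sqrt t ^ 2 := (Real.sq_sqrt ht.le).symm
  unfold YA YA1 YA2
  nth_rw 6 [this]
  field_simp
  ring

lemma YA2_continuousAt {t : ℝ} (ht : 0 < t) : ContinuousAt YA2 t := by
  have hs : 0 < Real.sqrt t := Real.sqrt_pos.2 ht
  unfold YA2
  have h1 := Real.continuous_sqrt.continuousAt (x := t)
  refine ContinuousAt.div_const ?_ _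
  refine (Real.continuous_exp.continuousAt.comp h1.neg).mul ?_
  refine ((continuousAt_const.div (h1.pow 3) (pow_pos hs _).ne').add (continuousAt_const.div (h1.pow 4) (pow_pos hs _).ne')).add
    (continuousAt_const.div (h1.pow 5) (pow_pos hs _).ne')

/-- The dominating kernel profile. -/
def kY (r : ℝ) : ℝ := Real.exp (-r) * (1 / r + 1 / r ^ 2)

lemma YA_nonneg (t : ℝ) : 0 ≤ YA t := by unfold YA; positivity

lemma YA_le {r t : ℝ} (hr : 0 < r) (h : r ^ 2 ≤ t) : |YA t| ≤ Real.exp (-r) / r := by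
  have hs : r ≤ Real.sqrt t := Real.le_sqrt_of_sq_le h
  rw [abs_of_nonneg (YA_nonneg t)]
  unfold YA
  gcongr

lemma YA1_le {r t : ℝ} (hr : 0 < r) (h : r ^ 2 ≤ t) : r * |YA1 t| ≤ kY r := by
  have hs : r ≤ Real.sqrt t := Real.le_sqrt_of_sq_le h
  have h1 : |YA1 t| ≤ Real.exp (-r) * (1 / r ^ 2 + 1 / r ^ 3) / 2 := by
    unfold YA1
    rw [neg_div, abs_neg, abs_of_nonneg (by positivity)]
    gcongr
  have h2 : r * (Real.exp (-r) * (1 / r ^ 2 + 1 / r ^ 3) / 2) = kY r / 2 := by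
    unfold kY; field_simp
  have h3 : 0 ≤ kY r := by unfold kY; positivity
  nlinarith [mul_le_mul_of_nonneg_left h1 hr.le]

lemma YA2_nonneg (t : ℝ) : 0 ≤ YA2 t := by unfold YA2; positivity

lemma YA2_le {r t : ℝ} (hr : 0 < r) (h : r ^ 2 ≤ t) : |YA2 t| ≤ Real.exp (-r) * (1 / r ^ 3 + 3 / r ^ 4 + 3 / r ^ 5) / 4 := by
  have hs : r ≤ Real.sqrt t := Real.le_sqrt_of_sq_le h
  rw [abs_of_nonneg (YA2_nonneg t)]
  unfold YA2
  gcongr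

/-- Continuous with polynomial growth. -/
def PB (F : E3 → ℝ) : Prop :=
  Continuous F ∧ ∃ (C : ℝ) (m : ℕ), 0 ≤ C ∧ ∀ z, |F z| ≤ C * (1 + ‖z‖ ^ 2) ^ m

lemma PB.add {F G : E3 → ℝ} (hF : PB F) (hG : PB G) : PB (fun z => F z + G z) := by
  obtain ⟨cF, C, m, hC, hm⟩ := hF
  obtain ⟨cG, D, n, hD, hn⟩ := hG
  refine ⟨cF.add cG, C + D, m + n, by positivity, fun z => ?_⟩
  have h1 : (1:ℝ) ≤ 1 + ‖z‖ ^ 2 := by nlinarith [sq_nonneg ‖z‖]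
  have h2 := pow_le_pow_right₀ h1 (Nat.le_add_right m n)
  have h3 := pow_le_pow_right₀ h1 (Nat.le_add_left n m)
  calc |F z + G z| ≤ |F z| + |G z| := abs_add_le _ _
    _ ≤ C * (1 + ‖z‖ ^ 2) ^ m + D * (1 + ‖z‖ ^ 2) ^ n := add_le_add (hm z) (hn z)
    _ ≤ C * (1 + ‖z‖ ^ 2) ^ (m + n) + D * (1 + ‖z‖ ^ 2) ^ (m + n) := by gcongr
    _ = _ := by ring

lemma PB.mul {F G : E3 → ℝ} (hF : PB F) (hG : PB G) : PB (fun z => F z * G z) := by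
  obtain ⟨cF, C, m, hC, hm⟩ := hF
  obtain ⟨cG, D, n, hD, hn⟩ := hG
  refine ⟨cF.mul cG, C * D, m + n, by positivity, fun z => ?_⟩
  rw [abs_mul, pow_add]
  calc |F z| * |G z| ≤ (C * (1 + ‖z‖ ^ 2) ^ m) * (D * (1 + ‖z‖ ^ 2) ^ n) := by
        gcongr
        · exact hm z
        · exact hn z
    _ = _ := by ring

lemma PB.const (c : ℝ) : PB (fun _ => c) :=
  ⟨continuous_const, |c|, 0, abs_nonneg _, fun z => by simp⟩

lemma PB.neg {F : E3 → ℝ} (hF : PB F) : PB (fun z => -F z) := by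
  simpa using (PB.const (-1)).mul hF

lemma PB.sub {F G : E3 → ℝ} (hF : PB F) (hG : PB G) : PB (fun z => F z - G z) := by
  simpa [sub_eq_add_neg] using hF.add hG.neg

lemma PB.sq {F : E3 → ℝ} (hF : PB F) : PB (fun z => F z ^ 2) := by
  simpa [_root_.sq] using hF.mul hF

lemma PB.sum {F : Fin 3 → E3 → ℝ} (hF : ∀ i, PB (F i)) : PB (fun z => ∑ i, F i z) := by
  simp only [Fin.sum_univ_three]
  exact ((hF 0).add (hF 1)).add (hF 2)

lemma PB.coord (i : Fin 3) : PB (fun z => z i) := by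
  refine ⟨by fun_prop, 1, 1, by positivity, fun z => ?_⟩
  have : |z i| ≤ ‖z‖ := PiLp.norm_apply_le z i
  nlinarith [sq_nonneg (‖z‖ - 1), sq_nonneg ‖z‖]

lemma PB.coord_sub (v : E3) (i : Fin 3) : PB (fun z => (z - v) i) := by
  simpa using (PB.coord i).sub (PB.const (v i))

lemma PB.rpow (q : ℝ) : PB (fun z => (1 + ‖z‖ ^ 2) ^ q) := by
  refine ⟨Continuous.rpow_const (by fun_prop) fun z => Or.inl (by positivity), 1, ⌈|q|⌉₊, by positivity, fun z => ?_⟩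
  have h1 : (1:ℝ) ≤ 1 + ‖z‖ ^ 2 := by nlinarith [sq_nonneg ‖z‖]
  rw [abs_of_nonneg (by positivity), one_mul, ← Real.rpow_natCast]
  exact Real.rpow_le_rpow_of_exponent_le h1 ((le_abs_self q).trans (Nat.le_ceil _))

lemma PB.of_bdd {F : E3 → ℝ} (hF : Continuous F) (C : ℝ) (h : ∀ z, |F z| ≤ C) : PB F :=
  ⟨hF, C, 0, (abs_nonneg _).trans (h 0), fun z => by simpa using h z⟩

open scoped SchwartzMap in
lemma PB.integrable {F : E3 → ℝ} (hF : PB F) (h : 𝓢(E3, ℝ)) : Integrable (fun z => F z * h z) := by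
  obtain ⟨cF, C, m, hC, hm⟩ := hF
  have ht := Function.hasTemperateGrowth_one_add_norm_sq_rpow E3 m
  have h1 := (SchwartzMap.smulLeftCLM ℝ (fun x : E3 => (1 + ‖x‖ ^ 2) ^ (m : ℝ)) h).integrable (μ := volume)
  refine (h1.const_mul C).norm.mono' (cF.mul h.continuous).aestronglyMeasurable (.of_forall fun z => ?_)
  rw [SchwartzMap.smulLeftCLM_apply_apply ht]
  simp only [norm_mul, Real.norm_eq_abs, smul_eq_mul, Real.rpow_natCast]
  rw [abs_of_nonneg hC, ← mul_assoc]
  gcongr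
  rw [abs_of_nonneg (a := (1 + ‖z‖ ^ 2) ^ m) (by positivity)]
  exact hm z

open scoped SchwartzMap LineDeriv in
lemma ibp {ψ ψ1 : E3 → ℝ} {e : E3} (hψ : PB ψ) (hψ1 : PB ψ1)
    (hd : ∀ x, HasLineDerivAt ℝ ψ (ψ1 x) x e) (h : 𝓢(E3, ℝ)) :
    ∫ z, ψ z * (∂_{e} h) z = -∫ z, ψ1 z * h z := by
  refine integral_bilinear_hasLineDerivAt_right_eq_neg_left_of_integrable (μ := volume)
    (f := ψ) (f' := ψ1) (g := h) (g' := fun z => (∂_{e} h) z) (v := e) (B := ContinuousLinearMap.mul ℝ ℝ)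
    (hψ1.integrable h) (hψ.integrable (∂_{e} h)) (hψ.integrable h) (fun x _ => hd x) (fun x _ => ?_)
  rw [SchwartzMap.lineDerivOp_apply_eq_fderiv]
  exact h.differentiableAt.hasFDerivAt.hasLineDerivAt e

/-- The smooth-kernel, pre-limit right-hand side. -/
def Skern (ε q : ℝ) (v z : E3) : ℝ :=
  -(8 * inner ℝ (z - v) z * YA1 (ε ^ 2 + ‖z - v‖ ^ 2) * (q * (1 + ‖z‖ ^ 2) ^ (q - 1)))
  - YA (ε ^ 2 + ‖z - v‖ ^ 2) * (6 * (q * (1 + ‖z‖ ^ 2) ^ (q - 1)) +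
      4 * ‖z‖ ^ 2 * (q * (q - 1) * (1 + ‖z‖ ^ 2) ^ (q - 2)))

lemma PB.YAs {ε : ℝ} (hε : 0 < ε) (v : E3) : PB (fun z => YA (ε ^ 2 + ‖z - v‖ ^ 2)) ∧
    PB (fun z => YA1 (ε ^ 2 + ‖z - v‖ ^ 2)) ∧ PB (fun z => YA2 (ε ^ 2 + ‖z - v‖ ^ 2)) := by
  have hpos : ∀ z, 0 < ε ^ 2 + ‖z - v‖ ^ 2 := fun z => by positivity
  have hle : ∀ z, ε ^ 2 ≤ ε ^ 2 + ‖z - v‖ ^ 2 := fun z => by nlinarith [sq_nonneg ‖z - v‖]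
  have hc : Continuous fun z : E3 => ε ^ 2 + ‖z - v‖ ^ 2 := by fun_prop
  refine ⟨PB.of_bdd ?_ _ (fun z => YA_le hε (hle z)), PB.of_bdd ?_ (kY ε / ε) (fun z => ?_),
    PB.of_bdd ?_ _ (fun z => YA2_le hε (hle z))⟩
  · exact continuous_iff_continuousAt.2 fun z =>
      (YA_hasDerivAt (hpos z)).continuousAt.comp (f := fun z : E3 => ε ^ 2 + ‖z - v‖ ^ 2) hc.continuousAt
  · exact continuous_iff_continuousAt.2 fun z =>
      (YA1_hasDerivAt (hpos z)).continuousAt.comp (f := fun z : E3 => ε ^ 2 + ‖z - v‖ ^ 2) hc.continuousAt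
  · have := YA1_le hε (hle z)
    rw [le_div_iff₀ hε]; linarith
  · exact continuous_iff_continuousAt.2 fun z =>
      (YA2_continuousAt (hpos z)).comp (f := fun z : E3 => ε ^ 2 + ‖z - v‖ ^ 2) hc.continuousAt

lemma line_normsq (v z : E3) (i : Fin 3) :
    HasDerivAt (fun t : ℝ => ‖z + t • EuclideanSpace.single i (1:ℝ) - v‖ ^ 2) (2 * (z - v) i) 0 := by
  have h1 : HasDerivAt (fun t : ℝ => z + t • EuclideanSpace.single i (1:ℝ) - v)
      (EuclideanSpace.single i (1:ℝ)) 0 := by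
    simpa using (((hasDerivAt_id (0:ℝ)).smul_const (EuclideanSpace.single i (1:ℝ))).const_add z).sub_const v
  have := h1.norm_sq
  simpa [EuclideanSpace.inner_single_right] using this

lemma line_coord (z : E3) (i : Fin 3) :
    HasDerivAt (fun t : ℝ => (z + t • EuclideanSpace.single i (1:ℝ)) i) 1 0 := by
  have : (fun t : ℝ => (z + t • EuclideanSpace.single i (1:ℝ)) i) = fun t => z i + t := by
    funext t; simp
  rw [this]
  exact (hasDerivAt_id (0:ℝ)).const_add _

lemma line_coord_sub (v z : E3) (i : Fin 3) :
    HasDerivAt (fun t : ℝ => (z + t • EuclideanSpace.single i (1:ℝ) - v) i) 1 0 := by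
  simpa using (line_coord z i).sub_const (v i)

lemma line_comp {Φ : ℝ → ℝ} {d c : ℝ} (v z : E3) (i : Fin 3)
    (h : HasDerivAt Φ d (c + ‖z - v‖ ^ 2)) :
    HasDerivAt (fun t : ℝ => Φ (c + ‖z + t • EuclideanSpace.single i (1:ℝ) - v‖ ^ 2))
      (d * (2 * (z - v) i)) 0 := by
  have h1 := (line_normsq v z i).const_add c
  refine HasDerivAt.comp (h := fun t : ℝ => c + ‖z + t • EuclideanSpace.single i (1:ℝ) - v‖ ^ 2) 0 ?_ h1
  simpa using h

lemma line_comp0 {Φ : ℝ → ℝ} {d c : ℝ} (z : E3) (i : Fin 3)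
    (h : HasDerivAt Φ d (c + ‖z‖ ^ 2)) :
    HasDerivAt (fun t : ℝ => Φ (c + ‖z + t • EuclideanSpace.single i (1:ℝ)‖ ^ 2))
      (d * (2 * z i)) 0 := by
  simpa using line_comp 0 z i (by simpa using h)

open scoped SchwartzMap LineDeriv in
lemma green_smooth {ε : ℝ} (hε : 0 < ε) (q : ℝ) (v : E3) (g h : 𝓢(E3, ℝ))
    (hg : ∀ x, g x = h x - ∑ i : Fin 3,
      (∂_{EuclideanSpace.single i (1:ℝ)} (∂_{EuclideanSpace.single i (1:ℝ)} h)) x) :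
    ∫ z, YA (ε ^ 2 + ‖z - v‖ ^ 2) * (1 + ‖z‖ ^ 2) ^ q * g z =
    (∫ z, 4 * ε ^ 2 * YA2 (ε ^ 2 + ‖z - v‖ ^ 2) * ((1 + ‖z‖ ^ 2) ^ q * h z)) +
      ∫ z, Skern ε q v z * h z := by
  obtain ⟨p0, p1, p2⟩ := PB.YAs hε v
  have b0 := PB.rpow q
  have b1 := (PB.const q).mul (PB.rpow (q - 1))
  have b2 := (PB.const (q * (q - 1))).mul (PB.rpow (q - 2))
  set A := fun z => YA (ε ^ 2 + ‖z - v‖ ^ 2) with hA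
  set A1 := fun z => YA1 (ε ^ 2 + ‖z - v‖ ^ 2) with hA1
  set A2 := fun z => YA2 (ε ^ 2 + ‖z - v‖ ^ 2) with hA2
  set B := fun z : E3 => (1 + ‖z‖ ^ 2) ^ q with hB
  set B1 := fun z : E3 => q * (1 + ‖z‖ ^ 2) ^ (q - 1) with hB1
  set B2 := fun z : E3 => q * (q - 1) * (1 + ‖z‖ ^ 2) ^ (q - 2) with hB2
  have hpos : ∀ z, 0 < ε ^ 2 + ‖z - v‖ ^ 2 := fun z => by positivity
  have hpos1 : ∀ z : E3, 0 < 1 + ‖z‖ ^ 2 := fun z => by positivity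
  have dA : ∀ z i, HasDerivAt (fun t : ℝ => A (z + t • EuclideanSpace.single i (1:ℝ)))
      (A1 z * (2 * (z - v) i)) 0 := fun z i => line_comp v z i (YA_hasDerivAt (hpos z))
  have dA1 : ∀ z i, HasDerivAt (fun t : ℝ => A1 (z + t • EuclideanSpace.single i (1:ℝ)))
      (A2 z * (2 * (z - v) i)) 0 := fun z i => line_comp v z i (YA1_hasDerivAt (hpos z))
  have dB : ∀ z i, HasDerivAt (fun t : ℝ => B (z + t • EuclideanSpace.single i (1:ℝ)))
      (B1 z * (2 * z i)) 0 := fun z i =>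
    line_comp0 (Φ := fun s => s ^ q) z i (Real.hasDerivAt_rpow_const (Or.inl (hpos1 z).ne'))
  have dB1 : ∀ z i, HasDerivAt (fun t : ℝ => B1 (z + t • EuclideanSpace.single i (1:ℝ)))
      (B2 z * (2 * z i)) 0 := fun z i => by
    have := (Real.hasDerivAt_rpow_const (p := q - 1) (Or.inl (hpos1 z).ne')).const_mul q
    refine line_comp0 (Φ := fun s => q * s ^ (q - 1)) z i (this.congr_deriv ?_)
    rw [show q - 1 - 1 = q - 2 by ring]; ring
  -- first and second partial derivatives
  let ψ1 : Fin 3 → E3 → ℝ := fun i z => 2 * ((z - v) i * (A1 z * B z)) + 2 * (z i * (A z * B1 z))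
  let ψ2 : Fin 3 → E3 → ℝ := fun i z => 2 * (A1 z * B z) + 4 * ((z - v) i ^ 2 * (A2 z * B z))
    + 8 * (((z - v) i * z i) * (A1 z * B1 z)) + 2 * (A z * B1 z) + 4 * (z i ^ 2 * (A z * B2 z))
  have pψ : PB (fun z => A z * B z) := p0.mul b0
  have pψ1 : ∀ i, PB (ψ1 i) := fun i =>
    ((PB.const 2).mul ((PB.coord_sub v i).mul (p1.mul b0))).add
      ((PB.const 2).mul ((PB.coord i).mul (p0.mul b1)))
  have pψ2 : ∀ i, PB (ψ2 i) := fun i =>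
    (((((PB.const 2).mul (p1.mul b0)).add
      ((PB.const 4).mul ((PB.coord_sub v i).sq.mul (p2.mul b0)))).add
      ((PB.const 8).mul (((PB.coord_sub v i).mul (PB.coord i)).mul (p1.mul b1)))).add
      ((PB.const 2).mul (p0.mul b1))).add ((PB.const 4).mul ((PB.coord i).sq.mul (p0.mul b2)))
  have d1 : ∀ i x, HasLineDerivAt ℝ (fun z => A z * B z) (ψ1 i x) x (EuclideanSpace.single i (1:ℝ)) := by
    intro i x
    have := (dA x i).mul (dB x i)
    simp only [zero_smul, add_zero] at this
    refine HasDerivAt.congr_deriv this ?_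
    simp only [ψ1]; ring
  have d2 : ∀ i x, HasLineDerivAt ℝ (ψ1 i) (ψ2 i x) x (EuclideanSpace.single i (1:ℝ)) := by
    intro i x
    have := (((line_coord_sub v x i).mul ((dA1 x i).mul (dB x i))).const_mul 2).add
      (((line_coord x i).mul ((dA x i).mul (dB1 x i))).const_mul 2)
    simp only [zero_smul, add_zero, Pi.mul_apply] at this
    refine HasDerivAt.congr_deriv this ?_
    simp only [ψ2]; ring
  let D : Fin 3 → 𝓢(E3, ℝ) := fun i =>
    ∂_{EuclideanSpace.single i (1:ℝ)} (∂_{EuclideanSpace.single i (1:ℝ)} h)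
  have hib : ∀ i, ∫ z, (A z * B z) *
      (D i) z = ∫ z, ψ2 i z * h z := by
    intro i
    simp only [D]
    rw [ibp pψ (pψ1 i) (d1 i), ibp (pψ1 i) (pψ2 i) (d2 i), neg_neg]
  have e1 : ∫ z, A z * B z * g z = (∫ z, A z * B z * h z) - ∑ i, ∫ z, ψ2 i z * h z := by
    have : ∀ z, A z * B z * g z = A z * B z * h z - ∑ i, (A z * B z) *
      (D i) z := by
      intro z; rw [hg z, ← Finset.mul_sum]; ring
    simp only [this]
    rw [integral_sub (pψ.integrable h) (integrable_finsetSum _ fun i _ => pψ.integrable _),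
      integral_finsetSum _ fun i _ => pψ.integrable _]
    simp only [hib]
  rw [e1]
  have hD : PB (fun z => 4 * ε ^ 2 * A2 z * B z) := ((PB.const _).mul p2).mul b0
  have pointwise : ∀ z, Skern ε q v z = A z * B z - (∑ i, ψ2 i z) - 4 * ε ^ 2 * A2 z * B z := by
    intro z
    have hode := YA_ode (hpos z)
    have i1 : (inner ℝ (z - v) z : ℝ) = ∑ i, (z - v) i * z i := by
      rw [PiLp.inner_apply]; simp [mul_comm]
    have i2 : ‖z - v‖ ^ 2 = ∑ i, (z - v) i ^ 2 := by
      rw [EuclideanSpace.norm_sq_eq]; simp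
    have i3 : ‖z‖ ^ 2 = ∑ i, z i ^ 2 := by
      rw [EuclideanSpace.norm_sq_eq]; simp
    have hode' : A z = 6 * A1 z + 4 * (ε ^ 2 + ∑ i, (z - v) i ^ 2) * A2 z := by
      rw [← i2]; exact hode
    have : Skern ε q v z = -(8 * (∑ i, (z - v) i * z i) * A1 z * B1 z) - A z * (6 * B1 z + 4 * (∑ i, z i ^ 2) * B2 z) := by
      rw [← i1, ← i3]; rfl
    rw [this]
    simp only [ψ2, Fin.sum_univ_three] at hode' ⊢
    linear_combination (-B z) * hode'
  have e2 : (∫ z, Skern ε q v z * h z) = (∫ z, A z * B z * h z) - (∑ i, ∫ z, ψ2 i z * h z)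
      - ∫ z, 4 * ε ^ 2 * A2 z * B z * h z := by
    rw [← integral_finsetSum _ fun i _ => (pψ2 i).integrable h, ← integral_sub (pψ.integrable h),
      ← integral_sub _ (hD.integrable h)]
    · congr 1; funext z
      rw [pointwise z, ← Finset.sum_mul]; ring
    · exact (pψ.integrable h).sub (integrable_finsetSum _ fun i _ => (pψ2 i).integrable h)
    · exact (integrable_finsetSum _ fun i _ => (pψ2 i).integrable h)
  rw [e2]
  have e3 : ∫ z, 4 * ε ^ 2 * YA2 (ε ^ 2 + ‖z - v‖ ^ 2) * (B z * h z) = ∫ z, 4 * ε ^ 2 * A2 z * B z * h z := by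
    congr 1; funext z; simp only [hA2]; ring
  linarith

lemma kernel_integrable {c : ℝ} (hc : 0 < c) :
    Integrable (fun x : E3 => Real.exp (-c * ‖x‖) * (1 / ‖x‖ + 1 / ‖x‖ ^ 2)) := by
  have h := (integrable_fun_norm_addHaar (volume : Measure E3)
    (f := fun r => Real.exp (-c * r) * (1 / r + 1 / r ^ 2))).2
  refine h ?_
  have h1 := integrableOn_rpow_mul_exp_neg_mul_rpow (p := 1) (s := 1) (b := c) (by norm_num) (by norm_num) hc
  have h2 := integrableOn_rpow_mul_exp_neg_mul_rpow (p := 1) (s := 0) (b := c) (by norm_num) (by norm_num) hc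
  refine (h1.add h2).congr_fun (fun r hr => ?_) measurableSet_Ioi
  have hr' : 0 < r := hr
  simp only [Pi.add_apply, Real.rpow_one, Real.rpow_zero, finrank_euclideanSpace, Fintype.card_fin, smul_eq_mul]
  norm_num
  field_simp

lemma kY_integrable (v : E3) : Integrable (fun z : E3 => kY ‖z - v‖) := by
  have := (kernel_integrable (c := 1) one_pos).comp_sub_right v
  simpa [kY] using this

lemma kY_nonneg {r : ℝ} (hr : 0 ≤ r) : 0 ≤ kY r := by unfold kY; positivity

lemma exp_div_le_kY {r : ℝ} (hr : 0 < r) : Real.exp (-r) / r ≤ kY r := by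
  unfold kY
  have : Real.exp (-r) / r = Real.exp (-r) * (1 / r) := by ring
  rw [this]
  gcongr
  have : 0 ≤ 1 / r ^ 2 := by positivity
  linarith

/-- Constant in the kernel bound. -/
def Cq (q : ℝ) : ℝ := 14 * |q| + 4 * |q * (q - 1)|

lemma Cq_nonneg (q : ℝ) : 0 ≤ Cq q := by unfold Cq; positivity

lemma Skern_bound (ε q : ℝ) {v z : E3} (hz : z ≠ v) :
    |Skern ε q v z| ≤ Cq q * (kY ‖z - v‖ * (1 + ‖z‖ ^ 2) ^ q) := by
  have hr : 0 < ‖z - v‖ := norm_pos_iff.2 (sub_ne_zero.2 hz)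
  have hle : ‖z - v‖ ^ 2 ≤ ε ^ 2 + ‖z - v‖ ^ 2 := by nlinarith [sq_nonneg ε]
  have hA := (YA_le hr hle).trans (exp_div_le_kY hr)
  have hA1 := YA1_le hr hle
  have hk := kY_nonneg hr.le
  have hs : 0 < 1 + ‖z‖ ^ 2 := by positivity
  have hs1 : 1 ≤ 1 + ‖z‖ ^ 2 := by nlinarith [sq_nonneg ‖z‖]
  have hin : |(inner ℝ (z - v) z : ℝ)| ≤ ‖z - v‖ * ‖z‖ := abs_real_inner_le_norm _ _
  have e1 : (1 + ‖z‖ ^ 2) ^ q = (1 + ‖z‖ ^ 2) ^ (q - 1) * (1 + ‖z‖ ^ 2) := by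
    rw [← Real.rpow_add_one hs.ne']; congr 1; ring
  have e2 : (1 + ‖z‖ ^ 2) ^ (q - 1) = (1 + ‖z‖ ^ 2) ^ (q - 2) * (1 + ‖z‖ ^ 2) := by
    rw [← Real.rpow_add_one hs.ne']; congr 1; ring
  have n1 : 0 < (1 + ‖z‖ ^ 2) ^ (q - 1) := Real.rpow_pos_of_pos hs _
  have n2 : 0 < (1 + ‖z‖ ^ 2) ^ (q - 2) := Real.rpow_pos_of_pos hs _
  have n0 : 0 < (1 + ‖z‖ ^ 2) ^ q := Real.rpow_pos_of_pos hs _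
  have m1 : ‖z‖ * (1 + ‖z‖ ^ 2) ^ (q - 1) ≤ (1 + ‖z‖ ^ 2) ^ q := by
    rw [e1]; nlinarith [sq_nonneg (‖z‖ - 1), sq_nonneg ‖z‖]
  have m2 : (1 + ‖z‖ ^ 2) ^ (q - 1) ≤ (1 + ‖z‖ ^ 2) ^ q := by
    rw [e1]; nlinarith [sq_nonneg ‖z‖]
  have m3 : ‖z‖ ^ 2 * (1 + ‖z‖ ^ 2) ^ (q - 2) ≤ (1 + ‖z‖ ^ 2) ^ q := by
    refine le_trans ?_ m2
    rw [e2]; nlinarith [sq_nonneg ‖z‖]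
  set s0 := (1 + ‖z‖ ^ 2) ^ q
  set s1 := (1 + ‖z‖ ^ 2) ^ (q - 1)
  set s2 := (1 + ‖z‖ ^ 2) ^ (q - 2)
  have t1 : |8 * inner ℝ (z - v) z * YA1 (ε ^ 2 + ‖z - v‖ ^ 2) * (q * s1)| ≤ 8 * |q| * (kY ‖z - v‖ * s0) := by
    rw [abs_mul, abs_mul, abs_mul, abs_mul, abs_of_pos n1, abs_of_pos (by norm_num : (0:ℝ) < 8)]
    calc 8 * |(inner ℝ (z - v) z : ℝ)| * |YA1 (ε ^ 2 + ‖z - v‖ ^ 2)| * (|q| * s1)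
        ≤ 8 * (‖z - v‖ * ‖z‖) * |YA1 (ε ^ 2 + ‖z - v‖ ^ 2)| * (|q| * s1) := by gcongr
      _ = 8 * |q| * ((‖z - v‖ * |YA1 (ε ^ 2 + ‖z - v‖ ^ 2)|) * (‖z‖ * s1)) := by ring
      _ ≤ 8 * |q| * (kY ‖z - v‖ * s0) := by gcongr
  have t2 : |YA (ε ^ 2 + ‖z - v‖ ^ 2) * (6 * (q * s1) + 4 * ‖z‖ ^ 2 * (q * (q - 1) * s2))| ≤
      kY ‖z - v‖ * ((6 * |q| + 4 * |q * (q - 1)|) * s0) := by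
    rw [abs_mul]
    refine mul_le_mul hA ?_ (abs_nonneg _) hk
    calc |6 * (q * s1) + 4 * ‖z‖ ^ 2 * (q * (q - 1) * s2)|
        ≤ |6 * (q * s1)| + |4 * ‖z‖ ^ 2 * (q * (q - 1) * s2)| := abs_add_le _ _
      _ = 6 * |q| * s1 + 4 * |q * (q - 1)| * (‖z‖ ^ 2 * s2) := by
        rw [abs_mul, abs_mul q s1, abs_mul (4 * ‖z‖ ^ 2), abs_mul (q * (q - 1)) s2, abs_of_pos n1, abs_of_pos n2,
          abs_of_pos (by norm_num : (0:ℝ) < 6), abs_of_nonneg (by positivity : 0 ≤ 4 * ‖z‖ ^ 2)]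
        ring
      _ ≤ 6 * |q| * s0 + 4 * |q * (q - 1)| * s0 := by gcongr
      _ = _ := by ring
  unfold Skern
  calc _ ≤ _ := abs_sub _ _
    _ ≤ 8 * |q| * (kY ‖z - v‖ * s0) + kY ‖z - v‖ * ((6 * |q| + 4 * |q * (q - 1)|) * s0) := by
      rw [abs_neg]; exact add_le_add t1 t2
    _ = _ := by unfold Cq; ring

lemma YA_measurable : Measurable YA := by unfold YA; fun_prop
lemma YA1_measurable : Measurable YA1 := by unfold YA1; fun_prop

lemma Skern_measurable (ε q : ℝ) : Measurable (fun p : E3 × E3 => Skern ε q p.1 p.2) := by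
  unfold Skern
  have h1 : Measurable fun p : E3 × E3 => YA (ε ^ 2 + ‖p.2 - p.1‖ ^ 2) := YA_measurable.comp (by fun_prop)
  have h2 : Measurable fun p : E3 × E3 => YA1 (ε ^ 2 + ‖p.2 - p.1‖ ^ 2) := YA1_measurable.comp (by fun_prop)
  have h3 : Measurable fun p : E3 × E3 => (inner ℝ (p.2 - p.1) p.2 : ℝ) :=
    Continuous.measurable (by fun_prop)
  fun_prop

lemma ae_ne (v : E3) : ∀ᵐ z : E3, z ≠ v := by
  simp [ae_iff]

open Filter Topology

lemma Skern_tendsto (q : ℝ) {v z : E3} (hz : z ≠ v) :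
    Tendsto (fun ε => Skern ε q v z) (𝓝[>] 0) (𝓝 (Skern 0 q v z)) := by
  have hr : 0 < ‖z - v‖ := norm_pos_iff.2 (sub_ne_zero.2 hz)
  have hp : 0 < (0:ℝ) ^ 2 + ‖z - v‖ ^ 2 := by positivity
  have c0 : ContinuousAt (fun ε : ℝ => ε ^ 2 + ‖z - v‖ ^ 2) 0 := by fun_prop
  have c1 : ContinuousAt (fun ε : ℝ => YA (ε ^ 2 + ‖z - v‖ ^ 2)) 0 :=
    ContinuousAt.comp (f := fun ε : ℝ => ε ^ 2 + ‖z - v‖ ^ 2) (YA_hasDerivAt hp).continuousAt c0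
  have c2 : ContinuousAt (fun ε : ℝ => YA1 (ε ^ 2 + ‖z - v‖ ^ 2)) 0 :=
    ContinuousAt.comp (f := fun ε : ℝ => ε ^ 2 + ‖z - v‖ ^ 2) (YA1_hasDerivAt hp).continuousAt c0
  have : ContinuousAt (fun ε => Skern ε q v z) 0 := by
    unfold Skern
    fun_prop
  exact this.tendsto.mono_left nhdsWithin_le_nhds

lemma YA_tendsto {v z : E3} (hz : z ≠ v) :
    Tendsto (fun ε : ℝ => YA (ε ^ 2 + ‖z - v‖ ^ 2)) (𝓝[>] 0) (𝓝 (Real.exp (-‖v - z‖) / ‖v - z‖)) := by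
  have hr : 0 < ‖z - v‖ := norm_pos_iff.2 (sub_ne_zero.2 hz)
  have hp : 0 < (0:ℝ) ^ 2 + ‖z - v‖ ^ 2 := by positivity
  have c0 : ContinuousAt (fun ε : ℝ => ε ^ 2 + ‖z - v‖ ^ 2) 0 := by fun_prop
  have c1 : ContinuousAt (fun ε : ℝ => YA (ε ^ 2 + ‖z - v‖ ^ 2)) 0 :=
    ContinuousAt.comp (f := fun ε : ℝ => ε ^ 2 + ‖z - v‖ ^ 2) (YA_hasDerivAt hp).continuousAt c0
  have := c1.tendsto.mono_left (nhdsWithin_le_nhds (s := Ioi 0))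
  convert this using 2
  unfold YA
  simp [Real.sqrt_sq, norm_sub_rev]

/-- The mass of the approximate identity. -/
def cY : ℝ := ∫ y : E3, 3 / Real.sqrt (1 + ‖y‖ ^ 2) ^ 5

lemma rho_integrable : Integrable (fun y : E3 => 1 / Real.sqrt (1 + ‖y‖ ^ 2) ^ 5) := by
  have := integrable_rpow_neg_one_add_norm_sq (E := E3) (μ := volume) (r := 5) (by simp; norm_num)
  refine this.congr (.of_forall fun y => ?_)
  have h : 0 ≤ 1 + ‖y‖ ^ 2 := by positivity
  simp only
  rw [Real.sqrt_eq_rpow, ← Real.rpow_natCast (n := 5), ← Real.rpow_mul h, neg_div, Real.rpow_neg h, one_div]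
  norm_num

lemma cY_pos : 0 < cY := by
  unfold cY
  have hpos : ∀ y : E3, 0 < 3 / Real.sqrt (1 + ‖y‖ ^ 2) ^ 5 := fun y => by positivity
  rw [integral_pos_iff_support_of_nonneg (fun y => (hpos y).le)]
  · have : Function.support (fun y : E3 => 3 / Real.sqrt (1 + ‖y‖ ^ 2) ^ 5) = univ := by
      ext y; simpa using (hpos y).ne'
    rw [this]; simp
  · refine (rho_integrable.const_mul 3).congr (.of_forall fun y => ?_)
    simp only; ring

lemma approx_id {H : E3 → ℝ} (hc : Continuous H) {M : ℝ} (hM : ∀ z, |H z| ≤ M) (v : E3) :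
    Tendsto (fun ε : ℝ => ∫ z, 4 * ε ^ 2 * YA2 (ε ^ 2 + ‖z - v‖ ^ 2) * H z) (𝓝[>] 0) (𝓝 (cY * H v)) := by
  have hM0 : 0 ≤ M := (abs_nonneg _).trans (hM 0)
  let κ : ℝ → E3 → ℝ := fun ε y => Real.exp (-(ε * Real.sqrt (1 + ‖y‖ ^ 2))) *
    (ε ^ 2 / Real.sqrt (1 + ‖y‖ ^ 2) ^ 3 + 3 * ε / Real.sqrt (1 + ‖y‖ ^ 2) ^ 4 + 3 / Real.sqrt (1 + ‖y‖ ^ 2) ^ 5)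
  have key : ∀ ε > 0, ∫ z, 4 * ε ^ 2 * YA2 (ε ^ 2 + ‖z - v‖ ^ 2) * H z = ∫ y, κ ε y * H (v + ε • y) := by
    intro ε hε
    have e1 := integral_add_left_eq_self (μ := volume) (fun z : E3 => 4 * ε ^ 2 * YA2 (ε ^ 2 + ‖z - v‖ ^ 2) * H z) v
    rw [← e1]
    have e2 := Measure.integral_comp_smul (volume : Measure E3)
      (fun z : E3 => 4 * ε ^ 2 * YA2 (ε ^ 2 + ‖v + z - v‖ ^ 2) * H (v + z)) ε
    rw [finrank_euclideanSpace, Fintype.card_fin, abs_of_pos (by positivity), smul_eq_mul] at e2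
    have e3 : ∀ I J : ℝ, J = (ε ^ 3)⁻¹ * I → I = ε ^ 3 * J := by
      intro I J h; rw [h]; field_simp
    rw [e3 _ _ e2, ← integral_const_mul]
    congr 1; funext y
    have hs : 0 < Real.sqrt (1 + ‖y‖ ^ 2) := Real.sqrt_pos.2 (by positivity)
    have : Real.sqrt (ε ^ 2 + ‖v + ε • y - v‖ ^ 2) = ε * Real.sqrt (1 + ‖y‖ ^ 2) := by
      rw [add_sub_cancel_left, norm_smul, Real.norm_eq_abs, abs_of_pos hε,
        show ε ^ 2 + (ε * ‖y‖) ^ 2 = ε ^ 2 * (1 + ‖y‖ ^ 2) by ring, Real.sqrt_mul (by positivity), Real.sqrt_sq hε.le]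
    simp only [κ]
    unfold YA2
    rw [this]
    field_simp
  have lim : Tendsto (fun ε : ℝ => ∫ y, κ ε y * H (v + ε • y)) (𝓝[>] 0)
      (𝓝 (∫ y : E3, 3 / Real.sqrt (1 + ‖y‖ ^ 2) ^ 5 * H v)) := by
    refine tendsto_integral_filter_of_dominated_convergence (fun y : E3 => 8 * M * (1 / Real.sqrt (1 + ‖y‖ ^ 2) ^ 5))
      ?_ ?_ (rho_integrable.const_mul _) ?_
    · refine .of_forall fun ε => Continuous.aestronglyMeasurable ?_
      have hs : ∀ y : E3, Real.sqrt (1 + ‖y‖ ^ 2) ≠ 0 := fun y => (Real.sqrt_pos.2 (by positivity)).ne'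
      simp only [κ]
      refine Continuous.mul (Continuous.mul (by fun_prop) ?_) (by fun_prop)
      refine ((Continuous.div (by fun_prop) (by fun_prop) fun y => pow_ne_zero _ (hs y)).add
        (Continuous.div (by fun_prop) (by fun_prop) fun y => pow_ne_zero _ (hs y))).add
        (Continuous.div (by fun_prop) (by fun_prop) fun y => pow_ne_zero _ (hs y))
    · filter_upwards [self_mem_nhdsWithin] with ε hε
      have hε : 0 < ε := hε
      refine .of_forall fun y => ?_
      have hs : 0 < Real.sqrt (1 + ‖y‖ ^ 2) := Real.sqrt_pos.2 (by positivity)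
      set ρ := Real.sqrt (1 + ‖y‖ ^ 2)
      have hk : κ ε y = Real.exp (-(ε * ρ)) * ((ε * ρ) ^ 2 + 3 * (ε * ρ) + 3) * (1 / ρ ^ 5) := by
        simp only [κ]
        change Real.exp (-(ε * ρ)) * (ε ^ 2 / ρ ^ 3 + 3 * ε / ρ ^ 4 + 3 / ρ ^ 5) = _
        field_simp
      have hu : 0 < ε * ρ := by positivity
      have hexp : Real.exp (-(ε * ρ)) * ((ε * ρ) ^ 2 + 3 * (ε * ρ) + 3) ≤ 8 := by
        rw [Real.exp_neg, inv_mul_le_iff₀ (Real.exp_pos _)]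
        have := Real.quadratic_le_exp_of_nonneg hu.le
        nlinarith
      rw [norm_mul, hk, Real.norm_eq_abs, Real.norm_eq_abs, abs_of_nonneg (by positivity)]
      calc _ ≤ 8 * (1 / ρ ^ 5) * M := by
            gcongr
            exact hM _
        _ = _ := by ring
    · refine .of_forall fun y => ?_
      have : Continuous fun ε : ℝ => κ ε y * H (v + ε • y) := by
        simp only [κ]
        fun_prop
      have h2 := (this.tendsto 0).mono_left (nhdsWithin_le_nhds (s := Ioi 0))
      simpa [κ] using h2
  rw [integral_mul_const] at lim
  refine lim.congr' ?_
  filter_upwards [self_mem_nhdsWithin] with ε hε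
  exact (key ε hε).symm

open scoped SchwartzMap in
lemma weighted_bdd (q : ℝ) (h : 𝓢(E3, ℝ)) : ∃ M, ∀ z, |(1 + ‖z‖ ^ 2) ^ q * h z| ≤ M := by
  have ht := Function.hasTemperateGrowth_one_add_norm_sq_rpow E3 q
  have h1 := (SchwartzMap.smulLeftCLM ℝ (fun x : E3 => (1 + ‖x‖ ^ 2) ^ q) h).toBoundedContinuousFunction.norm_coe_le_norm
  refine ⟨‖(SchwartzMap.smulLeftCLM ℝ (fun x : E3 => (1 + ‖x‖ ^ 2) ^ q) h).toBoundedContinuousFunction‖, fun z => ?_⟩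
  have := h1 z
  simpa [SchwartzMap.smulLeftCLM_apply_apply ht] using this

lemma newton_integrable (v : E3) {F : E3 → ℝ} (hF : Continuous F) {M : ℝ} (hM : ∀ z, |F z| ≤ M) :
    Integrable (fun z => Real.exp (-‖v - z‖) / ‖v - z‖ * F z) := by
  refine ((kY_integrable v).mul_const M).mono' ?_ ?_
  · exact (Measurable.mul (by fun_prop) hF.measurable).aestronglyMeasurable
  · filter_upwards [ae_ne v] with z hz
    have hr : 0 < ‖z - v‖ := norm_pos_iff.2 (sub_ne_zero.2 hz)
    rw [norm_mul, norm_sub_rev v z, Real.norm_eq_abs, abs_of_nonneg (by positivity)]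
    exact mul_le_mul (exp_div_le_kY hr) (hM z) (norm_nonneg _) (kY_nonneg hr.le)

open scoped SchwartzMap LineDeriv in
lemma green_identity (q : ℝ) (v : E3) (g h : 𝓢(E3, ℝ))
    (hg : ∀ x, g x = h x - ∑ i : Fin 3,
      (∂_{EuclideanSpace.single i (1:ℝ)} (∂_{EuclideanSpace.single i (1:ℝ)} h)) x) :
    ∫ z, Real.exp (-‖v - z‖) / ‖v - z‖ * ((1 + ‖z‖ ^ 2) ^ q * g z) =
      cY * ((1 + ‖v‖ ^ 2) ^ q * h v) + ∫ z, Skern 0 q v z * h z := by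
  obtain ⟨Mg, hMg⟩ := weighted_bdd q g
  obtain ⟨Mh, hMh⟩ := weighted_bdd q h
  have cw : Continuous fun z : E3 => (1 + ‖z‖ ^ 2) ^ q := (PB.rpow q).1
  have L1 : Tendsto (fun ε : ℝ => ∫ z, YA (ε ^ 2 + ‖z - v‖ ^ 2) * (1 + ‖z‖ ^ 2) ^ q * g z) (𝓝[>] 0)
      (𝓝 (∫ z, Real.exp (-‖v - z‖) / ‖v - z‖ * ((1 + ‖z‖ ^ 2) ^ q * g z))) := by
    refine tendsto_integral_filter_of_dominated_convergence (fun z : E3 => kY ‖z - v‖ * Mg) ?_ ?_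
      ((kY_integrable v).mul_const _) ?_
    · refine .of_forall fun ε => Measurable.aestronglyMeasurable ?_
      exact ((YA_measurable.comp (by fun_prop)).mul cw.measurable).mul g.continuous.measurable
    · refine .of_forall fun ε => ?_
      filter_upwards [ae_ne v] with z hz
      have hr : 0 < ‖z - v‖ := norm_pos_iff.2 (sub_ne_zero.2 hz)
      have hle : ‖z - v‖ ^ 2 ≤ ε ^ 2 + ‖z - v‖ ^ 2 := by nlinarith [sq_nonneg ε]
      rw [mul_assoc, norm_mul]
      exact mul_le_mul ((YA_le hr hle).trans (exp_div_le_kY hr)) (hMg z) (norm_nonneg _) (kY_nonneg hr.le)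
    · filter_upwards [ae_ne v] with z hz
      simp only [mul_assoc]
      exact (YA_tendsto hz).mul_const _
  have L2 : Tendsto (fun ε : ℝ => ∫ z, Skern ε q v z * h z) (𝓝[>] 0) (𝓝 (∫ z, Skern 0 q v z * h z)) := by
    refine tendsto_integral_filter_of_dominated_convergence (fun z : E3 => Cq q * Mh * kY ‖z - v‖) ?_ ?_
      ((kY_integrable v).const_mul _) ?_
    · refine .of_forall fun ε => Measurable.aestronglyMeasurable ?_
      exact ((Skern_measurable ε q).comp (measurable_const.prodMk measurable_id)).mul h.continuous.measurable
    · refine .of_forall fun ε => ?_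
      filter_upwards [ae_ne v] with z hz
      have hr : 0 < ‖z - v‖ := norm_pos_iff.2 (sub_ne_zero.2 hz)
      have hk := kY_nonneg hr.le
      have hC := Cq_nonneg q
      have h3 := hMh z
      rw [abs_mul, abs_of_nonneg (by positivity : 0 ≤ (1 + ‖z‖ ^ 2) ^ q)] at h3
      rw [norm_mul, Real.norm_eq_abs, Real.norm_eq_abs]
      calc |Skern ε q v z| * |h z| ≤ Cq q * (kY ‖z - v‖ * (1 + ‖z‖ ^ 2) ^ q) * |h z| := by
            gcongr; exact Skern_bound ε q hz
        _ = Cq q * kY ‖z - v‖ * ((1 + ‖z‖ ^ 2) ^ q * |h z|) := by ring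
        _ ≤ Cq q * kY ‖z - v‖ * Mh := by gcongr
        _ = _ := by ring
    · filter_upwards [ae_ne v] with z hz
      exact (Skern_tendsto q hz).mul_const _
  have L3 := approx_id (cw.mul h.continuous) hMh v
  have L4 := L3.add L2
  refine tendsto_nhds_unique (L1.congr' ?_) L4
  filter_upwards [self_mem_nhdsWithin] with ε hε
  exact green_smooth hε q v g h hg

lemma schur {p : ℝ} (hp : 1 < p) {K u : E3 → ℝ≥0∞} (hK : Measurable K) (hu : Measurable u) :
    (∫⁻ v, (∫⁻ z, K (z - v) * u z) ^ p) ^ (1 / p) ≤ (∫⁻ x, K x) * (∫⁻ z, u z ^ p) ^ (1 / p) := by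
  have hp0 : 0 < p := by linarith
  set r := p.conjExponent with hr
  have hpr : p.HolderConjugate r := Real.HolderConjugate.conjExponent hp
  have hr0 : 0 < r := hpr.symm.pos
  have hsum : 1 / p + 1 / r = 1 := by simpa [one_div] using hpr.inv_add_inv_eq_one
  set I := ∫⁻ x, K x with hI
  have hKv : ∀ v, ∫⁻ z, K (z - v) = I := fun v => lintegral_sub_right_eq_self K v
  have hKz : ∀ z, ∫⁻ v, K (z - v) = I := fun z => lintegral_sub_left_eq_self K z
  have hKm : ∀ v, Measurable fun z => K (z - v) := fun v => hK.comp (by fun_prop)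
  have step : ∀ v, (∫⁻ z, K (z - v) * u z) ^ p ≤ I ^ (p / r) * ∫⁻ z, K (z - v) * u z ^ p := by
    intro v
    have h1 := ENNReal.lintegral_mul_le_Lp_mul_Lq volume hpr
      (f := fun z => K (z - v) ^ (1 / p) * u z) (g := fun z => K (z - v) ^ (1 / r))
      (((hKm v).pow_const _).mul hu).aemeasurable ((hKm v).pow_const _).aemeasurable
    have e1 : ∀ z, ((fun z => K (z - v) ^ (1 / p) * u z) * fun z => K (z - v) ^ (1 / r)) z = K (z - v) * u z := by
      intro z
      simp only [Pi.mul_apply]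
      rw [mul_right_comm, ← ENNReal.rpow_add_of_nonneg _ _ (by positivity) (by positivity), hsum, ENNReal.rpow_one]
    have e2 : ∀ z, (K (z - v) ^ (1 / p) * u z) ^ p = K (z - v) * u z ^ p := by
      intro z
      rw [ENNReal.mul_rpow_of_nonneg _ _ hp0.le, ← ENNReal.rpow_mul, one_div, inv_mul_cancel₀ hp0.ne', ENNReal.rpow_one]
    have e3 : ∀ z, (K (z - v) ^ (1 / r)) ^ r = K (z - v) := by
      intro z
      rw [← ENNReal.rpow_mul, one_div, inv_mul_cancel₀ hr0.ne', ENNReal.rpow_one]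
    simp only [e1, e2, e3, hKv] at h1
    calc (∫⁻ z, K (z - v) * u z) ^ p ≤ ((∫⁻ z, K (z - v) * u z ^ p) ^ (1 / p) * I ^ (1 / r)) ^ p :=
          ENNReal.rpow_le_rpow h1 hp0.le
      _ = I ^ (p / r) * ∫⁻ z, K (z - v) * u z ^ p := by
        rw [ENNReal.mul_rpow_of_nonneg _ _ hp0.le, ← ENNReal.rpow_mul, ← ENNReal.rpow_mul, one_div,
          inv_mul_cancel₀ hp0.ne', ENNReal.rpow_one, mul_comm]
        congr 2; field_simp
  have hm2 : Measurable fun x : E3 × E3 => K (x.2 - x.1) * u x.2 ^ p :=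
    (hK.comp (by fun_prop)).mul ((hu.comp measurable_snd).pow_const _)
  have tot : ∫⁻ v, (∫⁻ z, K (z - v) * u z) ^ p ≤ I ^ p * ∫⁻ z, u z ^ p := by
    calc ∫⁻ v, (∫⁻ z, K (z - v) * u z) ^ p ≤ ∫⁻ v, I ^ (p / r) * ∫⁻ z, K (z - v) * u z ^ p := lintegral_mono step
      _ = I ^ (p / r) * ∫⁻ v, ∫⁻ z, K (z - v) * u z ^ p := by
        rw [lintegral_const_mul _ (Measurable.lintegral_prod_right' hm2)]
      _ = I ^ (p / r) * ∫⁻ z, ∫⁻ v, K (z - v) * u z ^ p := by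
        rw [lintegral_lintegral_swap hm2.aemeasurable]
      _ = I ^ (p / r) * ∫⁻ z, I * u z ^ p := by
        congr 1
        refine lintegral_congr fun z => ?_
        have hm : Measurable fun v => K (z - v) := hK.comp (by fun_prop)
        rw [lintegral_mul_const _ hm, hKz]
      _ = I ^ (p / r) * (I * ∫⁻ z, u z ^ p) := by
        rw [lintegral_const_mul _ (hu.pow_const _)]
      _ = I ^ p * ∫⁻ z, u z ^ p := by
        rw [← mul_assoc]
        congr 1
        nth_rw 2 [← ENNReal.rpow_one I]
        rw [← ENNReal.rpow_add_of_nonneg _ _ (by positivity) zero_le_one]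
        congr 1
        have : p * (1 / p + 1 / r) = p := by rw [hsum, mul_one]
        rw [mul_add] at this
        rw [← this]; field_simp
        field_simp at this; linarith
  calc _ ≤ (I ^ p * ∫⁻ z, u z ^ p) ^ (1 / p) := ENNReal.rpow_le_rpow tot (by positivity)
    _ = _ := by
      rw [ENNReal.mul_rpow_of_nonneg _ _ (by positivity), ← ENNReal.rpow_mul, mul_one_div_cancel hp0.ne', ENNReal.rpow_one]

lemma lp_bound {p : ℝ} (hp : 1 < p) {K : E3 → ℝ≥0∞} (hK : Measurable K) {f a : E3 → ℝ} (ha : Measurable a)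
    (hf : ∀ v, ‖f v‖ₑ ≤ ‖a v‖ₑ + ∫⁻ z, K (z - v) * ‖a z‖ₑ) :
    eLpNorm f (ENNReal.ofReal p) volume ≤ (1 + ∫⁻ x, K x) * eLpNorm a (ENNReal.ofReal p) volume := by
  have hp0 : 0 < p := by linarith
  have h1 : ENNReal.ofReal p ≠ 0 := by simpa using hp0
  rw [eLpNorm_eq_lintegral_rpow_enorm_toReal h1 ENNReal.ofReal_ne_top,
    eLpNorm_eq_lintegral_rpow_enorm_toReal h1 ENNReal.ofReal_ne_top, ENNReal.toReal_ofReal hp0.le]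
  have hm2 : Measurable fun x : E3 × E3 => K (x.2 - x.1) * ‖a x.2‖ₑ :=
    (hK.comp (by fun_prop)).mul (ha.comp measurable_snd).enorm
  have hT : Measurable fun v => ∫⁻ z, K (z - v) * ‖a z‖ₑ := Measurable.lintegral_prod_right' hm2
  calc (∫⁻ v, ‖f v‖ₑ ^ p) ^ (1 / p)
      ≤ (∫⁻ v, ((fun v => ‖a v‖ₑ) + fun v => ∫⁻ z, K (z - v) * ‖a z‖ₑ) v ^ p) ^ (1 / p) := by
        gcongr with v
        exact hf v
    _ ≤ (∫⁻ v, ‖a v‖ₑ ^ p) ^ (1 / p) + (∫⁻ v, (∫⁻ z, K (z - v) * ‖a z‖ₑ) ^ p) ^ (1 / p) :=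
        ENNReal.lintegral_Lp_add_le ha.enorm.aemeasurable hT.aemeasurable hp.le
    _ ≤ (∫⁻ v, ‖a v‖ₑ ^ p) ^ (1 / p) + (∫⁻ x, K x) * (∫⁻ v, ‖a v‖ₑ ^ p) ^ (1 / p) := by
        gcongr
        exact schur hp hK ha.enorm
    _ = _ := by rw [add_mul, one_mul]

open scoped SchwartzMap in
lemma bessel_pointwise (q : ℝ) (g : 𝓢(E3, ℝ)) : Continuous (besselM g) ∧
    ∀ v, ‖besselM (fun z => (1 + ‖z‖ ^ 2) ^ q * g z) v - (1 + ‖v‖ ^ 2) ^ q * besselM g v‖ₑ ≤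
      ∫⁻ z, ENNReal.ofReal (Cq q / cY * kY ‖z - v‖) * ‖(1 + ‖z‖ ^ 2) ^ q * besselM g z‖ₑ := by
  obtain ⟨h, hg⟩ := exists_resolvent g
  have hc := cY_pos
  have S0 : ∀ v z, Skern 0 0 v z = 0 := by intro v z; simp [Skern]
  have hB : ∀ v, besselM g v = 1 / (4 * Real.pi) * (cY * h v) := by
    intro v
    have := green_identity 0 v g h hg
    simp only [S0, Real.rpow_zero, one_mul, zero_mul, integral_zero, add_zero] at this
    unfold besselM
    rw [this]
  refine ⟨?_, fun v => ?_⟩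
  · have : besselM g = fun v => 1 / (4 * Real.pi) * (cY * h v) := funext hB
    rw [this]
    have := h.continuous
    fun_prop
  have e1 : besselM (fun z => (1 + ‖z‖ ^ 2) ^ q * g z) v - (1 + ‖v‖ ^ 2) ^ q * besselM g v =
      ∫ z, 1 / (4 * Real.pi) * (Skern 0 q v z * h z) := by
    rw [hB, integral_const_mul]
    unfold besselM
    rw [green_identity q v g h hg]
    ring
  rw [e1]
  refine (enorm_integral_le_lintegral_enorm _).trans (lintegral_mono_ae ?_)
  filter_upwards [ae_ne v] with z hz
  have hS := Skern_bound 0 q hz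
  have hk := kY_nonneg (norm_nonneg (z - v))
  have hC := Cq_nonneg q
  rw [← ofReal_norm_eq_enorm, ← ofReal_norm_eq_enorm, ← ENNReal.ofReal_mul (by positivity)]
  refine ENNReal.ofReal_le_ofReal ?_
  rw [hB]
  simp only [norm_mul, Real.norm_eq_abs]
  rw [abs_of_pos hc, abs_of_pos (by positivity : 0 < 1 / (4 * Real.pi)),
    abs_of_nonneg (by positivity : 0 ≤ (1 + ‖z‖ ^ 2) ^ q)]
  calc 1 / (4 * Real.pi) * (|Skern 0 q v z| * |h z|)
      ≤ 1 / (4 * Real.pi) * ((Cq q * (kY ‖z - v‖ * (1 + ‖z‖ ^ 2) ^ q)) * |h z|) := by gcongr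
    _ = _ := by field_simp

lemma peetre (q : ℝ) (v z : E3) :
    (1 + ‖v‖ ^ 2) ^ q * (1 + ‖z‖ ^ 2) ^ (-q) ≤ (2 * (1 + ‖z - v‖ ^ 2)) ^ |q| := by
  have key : ∀ a b : E3, 1 + ‖a‖ ^ 2 ≤ (1 + ‖b‖ ^ 2) * (2 * (1 + ‖b - a‖ ^ 2)) := by
    intro a b
    have h1 : ‖a‖ ≤ ‖b‖ + ‖b - a‖ := by
      have := norm_sub_le b (b - a)
      simpa using this
    have h2 : ‖a‖ ^ 2 ≤ (‖b‖ + ‖b - a‖) ^ 2 := by gcongr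
    nlinarith [sq_nonneg (‖b‖ - ‖b - a‖), sq_nonneg (‖b‖ * ‖b - a‖)]
  have main : ∀ (a b : E3) (m : ℝ), 0 ≤ m →
      (1 + ‖a‖ ^ 2) ^ m * (1 + ‖b‖ ^ 2) ^ (-m) ≤ (2 * (1 + ‖b - a‖ ^ 2)) ^ m := by
    intro a b m hm
    have hb : 0 < 1 + ‖b‖ ^ 2 := by positivity
    rw [Real.rpow_neg hb.le, ← div_eq_mul_inv, div_le_iff₀ (by positivity),
      ← Real.mul_rpow (by positivity) (by positivity)]
    refine Real.rpow_le_rpow (by positivity) ?_ hm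
    have := key a b
    linarith
  rcases le_total 0 q with h | h
  · rw [abs_of_nonneg h]; exact main v z q h
  · rw [abs_of_nonpos h]
    have := main z v (-q) (by linarith)
    rw [neg_neg] at this
    rw [mul_comm, norm_sub_rev z v]; exact this

lemma growth (m : ℝ) : ∃ C > 0, ∀ r : ℝ, 0 ≤ r → (2 * (1 + r ^ 2)) ^ |m| ≤ C * Real.exp (r / 2) := by
  set n : ℕ := ⌈|m|⌉₊ + 1 with hn
  have hn1 : (1:ℝ) ≤ n := by rw [hn]; push_cast; linarith [Nat.cast_nonneg (α := ℝ) ⌈|m|⌉₊]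
  refine ⟨2 ^ n * (4 * n) ^ (2 * n), by positivity, fun r hr => ?_⟩
  have h1 : (1:ℝ) ≤ 2 * (1 + r ^ 2) := by nlinarith [sq_nonneg r]
  have h2 : |m| ≤ (n:ℝ) := by
    rw [hn]; push_cast; linarith [Nat.le_ceil |m|]
  have hx := Real.add_one_le_exp (r / (4 * n))
  have h3 : 1 + r ≤ 4 * n * Real.exp (r / (4 * n)) := by
    have : 1 + r ≤ 4 * n * (r / (4 * n) + 1) := by
      field_simp; linarith
    refine this.trans ?_
    gcongr
  calc (2 * (1 + r ^ 2)) ^ |m| ≤ (2 * (1 + r ^ 2)) ^ (n:ℝ) := Real.rpow_le_rpow_of_exponent_le h1 h2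
    _ = (2 * (1 + r ^ 2)) ^ n := Real.rpow_natCast _ _
    _ ≤ (2 * (1 + r) ^ 2) ^ n := by gcongr; nlinarith
    _ ≤ (2 * (4 * n * Real.exp (r / (4 * n))) ^ 2) ^ n := by gcongr
    _ = 2 ^ n * (4 * n) ^ (2 * n) * Real.exp (r / (4 * n)) ^ (2 * n) := by
      rw [mul_pow, mul_pow, mul_pow, pow_mul, pow_mul]; ring
    _ = _ := by
      rw [← Real.exp_nat_mul]
      congr 2
      push_cast; field_simp; ring

lemma jap_rpow (v : E3) (α : ℝ) : jap v ^ α = (1 + ‖v‖ ^ 2) ^ (α / 2) := by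
  unfold jap
  rw [Real.sqrt_eq_rpow, ← Real.rpow_mul (by positivity)]
  congr 1; ring

/-- Lemma 2.1(f), inequality (2.1): equivalence of the weighted norms
`‖𝓜(⟨·⟩^α f)‖_{L^p}` and `‖⟨·⟩^α 𝓜f‖_{L^p}` for `1 < p < ∞`, `α ∈ ℝ`. -/
theorem bessel_weight_equivalence (p α : ℝ) (hp : 1 < p) :
    ∃ C₁ > 0, ∃ C₂ > 0, ∀ f : SchwartzMap (EuclideanSpace ℝ (Fin 3)) ℝ,
      ENNReal.ofReal C₂ *
          eLpNorm (besselM fun v => jap v ^ α * f v) (ENNReal.ofReal p) volume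
        ≤ eLpNorm (fun v => jap v ^ α * besselM (⇑f) v) (ENNReal.ofReal p) volume ∧
      eLpNorm (fun v => jap v ^ α * besselM (⇑f) v) (ENNReal.ofReal p) volume
        ≤ ENNReal.ofReal C₁ *
            eLpNorm (besselM fun v => jap v ^ α * f v) (ENNReal.ofReal p) volume := by

  simp only [jap_rpow]
  set q := α / 2 with hq
  obtain ⟨G, hG, hgrow⟩ := growth q
  have hc := cY_pos
  let K1 : E3 → ℝ≥0∞ := fun x => ENNReal.ofReal (Cq q / cY * kY ‖x‖)
  let K2 : E3 → ℝ≥0∞ := fun x => ENNReal.ofReal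
    (Cq (-q) / cY * G * (Real.exp (-(1 / 2) * ‖x‖) * (1 / ‖x‖ + 1 / ‖x‖ ^ 2)))
  have hK1 : Measurable K1 := by simp only [K1, kY]; fun_prop
  have hK2 : Measurable K2 := by simp only [K2]; fun_prop
  have I1 : ∫⁻ x, K1 x ≠ ∞ := by
    have := ((kY_integrable 0).const_mul (Cq q / cY)).lintegral_lt_top
    simpa [K1] using this.ne
  have I2 : ∫⁻ x, K2 x ≠ ∞ :=
    ((kernel_integrable (c := 1 / 2) (by norm_num)).const_mul (Cq (-q) / cY * G)).lintegral_lt_top.ne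
  have T1 : 1 + ∫⁻ x, K1 x ≠ ∞ := ENNReal.add_ne_top.2 ⟨ENNReal.one_ne_top, I1⟩
  have T2 : 1 + ∫⁻ x, K2 x ≠ ∞ := ENNReal.add_ne_top.2 ⟨ENNReal.one_ne_top, I2⟩
  have P1 : 0 < (1 + ∫⁻ x, K1 x).toReal := ENNReal.toReal_pos (by simp) T1
  have P2 : 0 < (1 + ∫⁻ x, K2 x).toReal := ENNReal.toReal_pos (by simp) T2
  have cw : Continuous fun z : E3 => (1 + ‖z‖ ^ 2) ^ q := (PB.rpow q).1
  refine ⟨_, P2, _, inv_pos.2 P1, fun f => ?_⟩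
  have ht := Function.hasTemperateGrowth_one_add_norm_sq_rpow E3 q
  let g : SchwartzMap E3 ℝ := SchwartzMap.smulLeftCLM ℝ (fun x : E3 => (1 + ‖x‖ ^ 2) ^ q) f
  have hgf : ⇑g = fun v => (1 + ‖v‖ ^ 2) ^ q * f v := by
    funext v; simp [g, SchwartzMap.smulLeftCLM_apply_apply ht]
  obtain ⟨cf, bf⟩ := bessel_pointwise q f
  obtain ⟨cg, bg⟩ := bessel_pointwise (-q) g
  have hfg : (fun z => (1 + ‖z‖ ^ 2) ^ (-q) * g z) = ⇑f := by
    funext z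
    have : (0:ℝ) < 1 + ‖z‖ ^ 2 := by positivity
    rw [hgf]
    simp only
    rw [← mul_assoc, ← Real.rpow_add this]; simp
  rw [hfg] at bg
  rw [← hgf] at bf ⊢
  constructor
  · have := lp_bound hp hK1 (f := besselM g) (a := fun v => (1 + ‖v‖ ^ 2) ^ q * besselM f v)
      (cw.mul cf).measurable (fun v => by
        have h1 := bf v
        calc ‖besselM g v‖ₑ = ‖(1 + ‖v‖ ^ 2) ^ q * besselM f v +
              (besselM g v - (1 + ‖v‖ ^ 2) ^ q * besselM f v)‖ₑ := by congr 1; ring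
          _ ≤ _ := (enorm_add_le _ _).trans (add_le_add le_rfl h1))
    rw [ENNReal.ofReal_inv_of_pos P1, ENNReal.ofReal_toReal T1]
    rw [ENNReal.inv_mul_le_iff (by simp) T1]
    exact this
  · rw [ENNReal.ofReal_toReal T2]
    refine lp_bound hp hK2 cg.measurable (fun v => ?_)
    have h1 := bg v
    have hv : (0:ℝ) < 1 + ‖v‖ ^ 2 := by positivity
    have e : (1 + ‖v‖ ^ 2) ^ q * besselM f v = besselM g v +
        (1 + ‖v‖ ^ 2) ^ q * (besselM f v - (1 + ‖v‖ ^ 2) ^ (-q) * besselM g v) := by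
      have : (1 + ‖v‖ ^ 2) ^ q * (1 + ‖v‖ ^ 2) ^ (-q) = 1 := by
        rw [← Real.rpow_add hv]; simp
      linear_combination (besselM g v) * this
    rw [e]
    refine (enorm_add_le _ _).trans (add_le_add le_rfl ?_)
    rw [enorm_mul]
    refine (mul_le_mul_right h1 _).trans ?_
    rw [← lintegral_const_mul' _ _ enorm_ne_top]
    refine lintegral_mono fun z => ?_
    have hk := kY_nonneg (norm_nonneg (z - v))
    have hC := Cq_nonneg (-q)
    simp only [K2]
    rw [← ofReal_norm_eq_enorm, ← ofReal_norm_eq_enorm, ← ofReal_norm_eq_enorm,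
      ← ENNReal.ofReal_mul (by positivity), ← ENNReal.ofReal_mul (by positivity),
      ← ENNReal.ofReal_mul (by positivity)]
    refine ENNReal.ofReal_le_ofReal ?_
    simp only [norm_mul, Real.norm_eq_abs]
    rw [abs_of_nonneg (by positivity : 0 ≤ (1 + ‖z‖ ^ 2) ^ (-q)),
      abs_of_nonneg (by positivity : 0 ≤ (1 + ‖v‖ ^ 2) ^ q)]
    have h2 := (peetre q v z).trans (hgrow _ (norm_nonneg (z - v)))
    have h3 : Real.exp (‖z - v‖ / 2) * kY ‖z - v‖ =
        Real.exp (-(1 / 2) * ‖z - v‖) * (1 / ‖z - v‖ + 1 / ‖z - v‖ ^ 2) := by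
      unfold kY
      rw [← mul_assoc, ← Real.exp_add]
      congr 2; ring
    calc (1 + ‖v‖ ^ 2) ^ q * (Cq (-q) / cY * kY ‖z - v‖ * ((1 + ‖z‖ ^ 2) ^ (-q) * |besselM g z|))
        = Cq (-q) / cY * kY ‖z - v‖ * |besselM g z| * ((1 + ‖v‖ ^ 2) ^ q * (1 + ‖z‖ ^ 2) ^ (-q)) := by ring
      _ ≤ Cq (-q) / cY * kY ‖z - v‖ * |besselM g z| * (G * Real.exp (‖z - v‖ / 2)) := by gcongr
      _ = Cq (-q) / cY * G * (Real.exp (‖z - v‖ / 2) * kY ‖z - v‖) * |besselM g z| := by ring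
      _ = _ := by rw [h3]
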